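/- Let n ≥ 1 and let Γ be a finite subgroup of the orthogonal group O(n). The quotient metric space ℝⁿ/Γ is a CAT(0) space if and only if Γ is generated by reflections. -/

import Mathlib

open scoped RealInnerProductSpace

noncomputable section

/-- Euclidean space `ℝⁿ`. -/
abbrev E (n : ℕ) : Type := EuclideanSpace ℝ (Fin n)

/-- The orthogonal group `O(n)`, realized as the group of linear isometric
self-equivalences of `ℝⁿ`. -/
abbrev On (n : ℕ) : Type := E n ≃ₗᵢ[ℝ] E n

/-- The fixed-point subspace of a linear isometry. -/
def fixedSubmodule {K : Type} [NormedAddCommGroup K] [NormedSpace ℝ K]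
    (g : K ≃ₗᵢ[ℝ] K) : Submodule ℝ K :=
  LinearMap.eqLocus (g.toLinearEquiv : K →ₗ[ℝ] K) LinearMap.id

/-- A reflection is an orthogonal transformation whose fixed-point subspace is a
hyperplane (has codimension one). -/
def IsReflection {K : Type} [NormedAddCommGroup K] [NormedSpace ℝ K]
    (g : K ≃ₗᵢ[ℝ] K) : Prop :=
  Module.finrank ℝ (fixedSubmodule g) = Module.finrank ℝ K - 1

/-- A subgroup of `O(n)` is generated by reflections if it is the subgroup generated by
the reflections it contains. -/
def GeneratedByReflections {n : ℕ} (Γ : Subgroup (On n)) : Prop :=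
  Subgroup.closure {g : On n | g ∈ Γ ∧ IsReflection g} = Γ

/-- The orbit equivalence relation of `Γ ≤ O(n)` on `ℝⁿ`. -/
def orbitSetoid {n : ℕ} (Γ : Subgroup (On n)) : Setoid (E n) where
  r x y := ∃ g ∈ Γ, g y = x
  iseqv := by
    constructor
    · exact fun x => ⟨1, Γ.one_mem, rfl⟩
    · rintro x y ⟨g, hg, rfl⟩
      exact ⟨g⁻¹, Γ.inv_mem hg, g.symm_apply_apply y⟩
    · rintro x y z ⟨g, hg, rfl⟩ ⟨h, hh, rfl⟩
      exact ⟨g * h, Γ.mul_mem hg hh, rfl⟩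

/-- The quotient metric on the orbit space `ℝⁿ/Γ`:
`d(Γx, Γy) = min_{g ∈ Γ} ‖x - g y‖`. -/
def quotDist {n : ℕ} (Γ : Subgroup (On n)) (X Y : Quotient (orbitSetoid Γ)) : ℝ :=
  ⨅ g : Γ, dist X.out ((g : On n) Y.out)

/-- `γ` is a (unit-speed) geodesic from `p` to `q` with respect to the distance
function `d`. -/
def IsGeodesicFn {X : Type*} (d : X → X → ℝ) (p q : X) (γ : ℝ → X) : Prop :=
  γ 0 = p ∧ γ (d p q) = q ∧
    ∀ s ∈ Set.Icc (0 : ℝ) (d p q), ∀ t ∈ Set.Icc (0 : ℝ) (d p q), d (γ s) (γ t) = |s - t|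

/-- `d` is a metric: symmetric, separating and satisfying the triangle inequality. -/
def IsMetricFn {X : Type*} (d : X → X → ℝ) : Prop :=
  (∀ x y, d x y = 0 ↔ x = y) ∧ (∀ x y, d x y = d y x) ∧
    ∀ x y z, d x z ≤ d x y + d y z

/-- A distance function `d` on `X` makes `X` a CAT(0) space if it is a geodesic metric
space in which every geodesic triangle satisfies the CAT(0) comparison inequality with
respect to a Euclidean comparison triangle: for a triangle with vertices `p, q, r`,
sides issuing from `p` given by geodesics `γpq`, `γpr`, and a comparison triangle
`p', q', r'` in the Euclidean plane with the same side lengths, the distance between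
points on the two sides is bounded by the Euclidean distance between the comparison
points on the corresponding sides of the comparison triangle. -/
def IsCAT0 {X : Type*} (d : X → X → ℝ) : Prop :=
  IsMetricFn d ∧ (∀ p q : X, ∃ γ : ℝ → X, IsGeodesicFn d p q γ) ∧
    ∀ p q r : X, ∀ γpq γpr : ℝ → X, IsGeodesicFn d p q γpq → IsGeodesicFn d p r γpr →
      ∀ p' q' r' : EuclideanSpace ℝ (Fin 2),
        dist p' q' = d p q → dist p' r' = d p r → dist q' r' = d q r →
        ∀ s ∈ Set.Icc (0 : ℝ) (d p q), ∀ t ∈ Set.Icc (0 : ℝ) (d p r),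
          d (γpq s) (γpr t) ≤
            dist (AffineMap.lineMap p' q' (s / d p q)) (AffineMap.lineMap p' r' (t / d p r))

/-- The unit sphere `Sⁿ⁻¹ ⊆ ℝⁿ`. -/
abbrev Sph (n : ℕ) : Type := {v : E n // ‖v‖ = 1}

/-- The orbit equivalence relation of `Γ ≤ O(n)` on the unit sphere. -/
def sphSetoid {n : ℕ} (Γ : Subgroup (On n)) : Setoid (Sph n) where
  r x y := ∃ g ∈ Γ, g (y : E n) = (x : E n)
  iseqv := by
    constructor
    · exact fun x => ⟨1, Γ.one_mem, rfl⟩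
    · rintro ⟨x, hx⟩ ⟨y, hy⟩ ⟨g, hg, h⟩
      refine ⟨g⁻¹, Γ.inv_mem hg, ?_⟩
      simp only [Subtype.coe_mk] at h ⊢
      rw [← h]
      exact g.symm_apply_apply y
    · rintro x y z ⟨g, hg, h⟩ ⟨k, hk, h'⟩
      refine ⟨g * k, Γ.mul_mem hg hk, ?_⟩
      rw [← h, ← h']
      rfl

/-- The quotient metric on the orbit space `Sⁿ⁻¹/Γ`:
`d(Γu, Γv) = min_{g ∈ Γ} ∠(u, g v) = min_{g ∈ Γ} arccos ⟪u, g v⟫`. -/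
def sphDist {n : ℕ} (Γ : Subgroup (On n)) (X Y : Quotient (sphSetoid Γ)) : ℝ :=
  ⨅ g : Γ, Real.arccos ⟪(X.out : E n), (g : On n) (Y.out : E n)⟫

section Roots

variable {F : Type*} [NormedAddCommGroup F] [InnerProductSpace ℝ F]

/-- The orthogonal reflection in the hyperplane perpendicular to `α`. -/
def rootReflection (α : F) : F ≃ₗᵢ[ℝ] F := (ℝ ∙ α)ᗮ.reflection

lemma rootReflection_apply {α : F} (hα : ‖α‖ = 1) (x : F) :
    rootReflection α x = x - (2 * ⟪α, x⟫) • α := by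
  rw [rootReflection, Submodule.reflection_orthogonal_apply,
    Submodule.reflection_singleton_apply]
  simp [hα, mul_smul, two_smul]

@[simp]
lemma rootReflection_rootReflection (α x : F) :
    rootReflection α (rootReflection α x) = x :=
  Submodule.reflection_reflection _ _

@[simp]
lemma rootReflection_mul_self (α : F) : rootReflection α * rootReflection α = 1 :=
  Submodule.reflection_mul_reflection _

@[simp]
lemma rootReflection_mul_cancel_left (α : F) (g : F ≃ₗᵢ[ℝ] F) :
    rootReflection α * (rootReflection α * g) = g := by
  rw [← mul_assoc, rootReflection_mul_self, one_mul]

@[simp]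
lemma rootReflection_inv (α : F) : (rootReflection α)⁻¹ = rootReflection α := rfl

@[simp]
lemma rootReflection_symm (α : F) : (rootReflection α).symm = rootReflection α := rfl

lemma rootReflection_self (α : F) : rootReflection α α = -α :=
  Submodule.reflection_orthogonalComplement_singleton_eq_neg α

lemma rootReflection_neg (α : F) : rootReflection (-α) = rootReflection α := by
  have h : (ℝ ∙ (-α)) = ℝ ∙ α := by
    simpa using Submodule.span_singleton_smul_eq (R := ℝ) (isUnit_one.neg) α
  unfold rootReflection
  congr! 2

lemma rootReflection_map (g : F ≃ₗᵢ[ℝ] F) {α : F} (hα : ‖α‖ = 1) :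
    rootReflection (g α) = g * rootReflection α * g⁻¹ := by
  ext x
  have h : ⟪g α, x⟫ = ⟪α, g.symm x⟫ := by
    rw [← g.inner_map_map α, g.apply_symm_apply]
  change _ = g (rootReflection α (g.symm x))
  rw [rootReflection_apply hα, rootReflection_apply (by simpa using hα), h]
  simp

lemma eq_or_eq_neg_of_rootReflection_eq {α β : F} (hα : ‖α‖ = 1) (hβ : ‖β‖ = 1)
    (h : rootReflection α = rootReflection β) : β = α ∨ β = -α := by
  have h1 : rootReflection α β = -β := h ▸ rootReflection_self β
  rw [rootReflection_apply hα] at h1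
  have h2 : β = ⟪α, β⟫ • α := by
    have : (2 : ℝ) • β = (2 : ℝ) • ⟪α, β⟫ • α := by
      rw [smul_smul, two_smul, ← sub_eq_zero, add_sub_assoc, h1, add_neg_cancel]
    exact smul_right_injective F (two_ne_zero (α := ℝ)) this
  have h3 : |⟪α, β⟫| = 1 := by
    have := congrArg norm h2
    rwa [norm_smul, hα, hβ, mul_one, Real.norm_eq_abs, eq_comm] at this
  rcases eq_or_eq_neg_of_abs_eq h3 with h4 | h4 <;> rw [h4] at h2 <;> simp at h2 <;> simp [h2]

/-- `α` is a unit normal of a mirror of `Γ`, on the same side of the mirror as `x₀`. -/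
structure IsPosRoot (Γ : Subgroup (F ≃ₗᵢ[ℝ] F)) (x₀ α : F) : Prop where
  norm_eq : ‖α‖ = 1
  mem : rootReflection α ∈ Γ
  pos : 0 < ⟪α, x₀⟫

/-- A positive root is simple if its reflection permutes the other positive roots. -/
structure IsSimpleRoot (Γ : Subgroup (F ≃ₗᵢ[ℝ] F)) (x₀ α : F) : Prop where
  isPosRoot : IsPosRoot Γ x₀ α
  map_isPosRoot : ∀ β, IsPosRoot Γ x₀ β → β ≠ α → IsPosRoot Γ x₀ (rootReflection α β)

/-- The point `x₀` lies on no mirror of `Γ`. -/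
def IsOffMirrors (Γ : Subgroup (F ≃ₗᵢ[ℝ] F)) (x₀ : F) : Prop :=
  ∀ α, ‖α‖ = 1 → rootReflection α ∈ Γ → ⟪α, x₀⟫ ≠ 0

variable {Γ : Subgroup (F ≃ₗᵢ[ℝ] F)} {x₀ : F}

lemma finite_roots (Γ : Subgroup (F ≃ₗᵢ[ℝ] F)) [Finite Γ] :
    {α : F | ‖α‖ = 1 ∧ rootReflection α ∈ Γ}.Finite := by
  refine Set.Finite.of_finite_fibers (f := rootReflection)
    ((Set.toFinite (Γ : Set (F ≃ₗᵢ[ℝ] F))).subset ?_) ?_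
  · rintro _ ⟨α, hα, rfl⟩
    exact hα.2
  · rintro _ ⟨α, hα, rfl⟩
    refine (Set.toFinite {α, -α}).subset ?_
    rintro β ⟨hβ, h⟩
    exact eq_or_eq_neg_of_rootReflection_eq hα.1 hβ.1 h.symm

lemma IsPosRoot.map_or_neg (hx₀ : IsOffMirrors Γ x₀) {α : F} (hα : IsPosRoot Γ x₀ α)
    {g : F ≃ₗᵢ[ℝ] F} (hg : g ∈ Γ) : IsPosRoot Γ x₀ (g α) ∨ IsPosRoot Γ x₀ (-g α) := by
  have hn : ‖g α‖ = 1 := by simpa using hα.norm_eq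
  have hm : rootReflection (g α) ∈ Γ := by
    rw [rootReflection_map g hα.norm_eq]
    exact Γ.mul_mem (Γ.mul_mem hg hα.mem) (Γ.inv_mem hg)
  rcases (hx₀ _ hn hm).lt_or_gt with h | h
  · refine .inr ⟨by simpa using hn, by rwa [rootReflection_neg], ?_⟩
    rw [inner_neg_left]
    linarith
  · exact .inl ⟨hn, hm, h⟩

lemma rootReflection_mem_closure_simple [Finite Γ] (hx₀ : IsOffMirrors Γ x₀) {α : F}
    (hα : IsPosRoot Γ x₀ α) :
    rootReflection α ∈ Subgroup.closure (rootReflection '' {β | IsSimpleRoot Γ x₀ β}) := by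
  set S := Subgroup.closure (rootReflection '' {β | IsSimpleRoot Γ x₀ β})
  induction hk : {β | IsPosRoot Γ x₀ β ∧ ⟪β, x₀⟫ < ⟪α, x₀⟫}.ncard
    using Nat.strong_induction_on generalizing α with
  | _ k ih =>
    have lower : ∀ β, IsPosRoot Γ x₀ β → ⟪β, x₀⟫ < ⟪α, x₀⟫ → rootReflection β ∈ S := by
      intro β hβ hlt
      refine ih _ ?_ hβ rfl
      rw [← hk]
      refine Set.ncard_lt_ncard ?_ ((finite_roots Γ).subset fun γ hγ => ⟨hγ.1.1, hγ.1.2⟩)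
      refine ⟨fun γ hγ => ⟨hγ.1, hγ.2.trans hlt⟩, fun hsub => ?_⟩
      exact lt_irrefl _ (hsub (a := β) ⟨hβ, hlt⟩).2
    by_cases hs : IsSimpleRoot Γ x₀ α
    · exact Subgroup.subset_closure ⟨α, hs, rfl⟩
    -- A root sent to a negative root by the reflection, and lower than `α`, suffices.
    have key : ∀ β, IsPosRoot Γ x₀ β → β ≠ α → IsPosRoot Γ x₀ (-rootReflection α β) →
        ⟪β, x₀⟫ < ⟪α, x₀⟫ → rootReflection α ∈ S := by
      intro β hβ hne hneg hlt
      have hS := lower β hβ hlt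
      have hc1 : ⟪α, β⟫ < 1 := (inner_lt_one_iff_real_of_norm_eq_one hα.1 hβ.1).2 hne.symm
      have hnp := hneg.pos
      rw [rootReflection_apply hα.1, inner_neg_left, inner_sub_left, real_inner_smul_left] at hnp
      have hαp := hα.pos
      have hβp := hβ.pos
      have hc0 : 0 < ⟪α, β⟫ := by
        by_contra! h
        nlinarith
      have hh : ⟪rootReflection β α, x₀⟫ = ⟪α, x₀⟫ - 2 * ⟪α, β⟫ * ⟪β, x₀⟫ := by
        rw [rootReflection_apply hβ.1, inner_sub_left, real_inner_smul_left, real_inner_comm α β]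
      have hmem : rootReflection (rootReflection β α) ∈ S := by
        rcases hα.map_or_neg hx₀ hβ.mem with hp | hp
        · refine lower _ hp ?_
          rw [hh]
          nlinarith [mul_pos hc0 hβp]
        · rw [← rootReflection_neg]
          refine lower _ hp ?_
          rw [inner_neg_left, hh]
          nlinarith
      rw [rootReflection_map _ hα.1] at hmem
      have := S.mul_mem (S.mul_mem (S.inv_mem hS) hmem) hS
      simpa [mul_assoc] using this
    obtain ⟨β, hβ, hne, hnot⟩ : ∃ β, IsPosRoot Γ x₀ β ∧ β ≠ α ∧
        ¬ IsPosRoot Γ x₀ (rootReflection α β) := by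
      by_contra! h
      exact hs ⟨hα, h⟩
    have hneg := (hβ.map_or_neg hx₀ hα.mem).resolve_left hnot
    rcases lt_or_ge ⟪β, x₀⟫ ⟪α, x₀⟫ with hlt | hge
    · exact key β hβ hne hneg hlt
    · refine key _ hneg ?_ (by simpa using hβ) ?_
      · intro h
        refine hne ?_
        have := congrArg (rootReflection α) h
        rw [map_neg, rootReflection_rootReflection, rootReflection_self] at this
        exact neg_injective this
      · have hc1 : ⟪α, β⟫ < 1 := (inner_lt_one_iff_real_of_norm_eq_one hα.1 hβ.1).2 hne.symm
        have hαp := hα.pos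
        rw [rootReflection_apply hα.1, inner_neg_left, inner_sub_left, real_inner_smul_left]
        nlinarith

/-- The strong exchange property for words in simple reflections. -/
lemma exists_exchange (L : List F)
    (hL : ∀ β ∈ L, IsSimpleRoot Γ x₀ β) {α : F} (hα : IsPosRoot Γ x₀ α)
    (hneg : ¬ IsPosRoot Γ x₀ ((L.map rootReflection).prod⁻¹ α)) :
    ∃ L' : List F, (∀ β ∈ L', IsSimpleRoot Γ x₀ β) ∧ L'.length < L.length ∧
      (L'.map rootReflection).prod = rootReflection α * (L.map rootReflection).prod := by
  induction L generalizing α with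
  | nil => exact absurd (by simpa using hα) hneg
  | cons β L ih =>
    have hβ := hL β (by simp)
    have hL' : ∀ γ ∈ L, IsSimpleRoot Γ x₀ γ := fun γ hγ => hL γ (by simp [hγ])
    by_cases hαβ : α = β
    · subst hαβ
      exact ⟨L, hL', by simp, by simp [← mul_assoc]⟩
    · have hp := hβ.map_isPosRoot α hα hαβ
      obtain ⟨M, hM, hlen, hprod⟩ := ih hL' hp (by simpa using hneg)
      refine ⟨β :: M, ?_, by simpa using hlen, ?_⟩
      · rintro γ hγ
        rcases List.mem_cons.1 hγ with rfl | hγ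
        · exact hβ
        · exact hM γ hγ
      · simp [hprod, rootReflection_map _ hα.1, ← mul_assoc]

/-- The closed chamber of `Γ` containing `x₀`. -/
def chamber (Γ : Subgroup (F ≃ₗᵢ[ℝ] F)) (x₀ : F) : Set F :=
  {x | ∀ α, IsPosRoot Γ x₀ α → 0 ≤ ⟪α, x⟫}

lemma inner_list_prod_le {x y : F} (hx : x ∈ chamber Γ x₀)
    (hy : y ∈ chamber Γ x₀) (L : List F) (hL : ∀ β ∈ L, IsSimpleRoot Γ x₀ β) :
    ⟪x, (L.map rootReflection).prod y⟫ ≤ ⟪x, y⟫ := by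
  induction hk : L.length using Nat.strong_induction_on generalizing L with
  | _ k ih =>
    match L with
    | [] => simp
    | α :: M =>
      have hα := (hL α (by simp)).isPosRoot
      have hM : ∀ γ ∈ M, IsSimpleRoot Γ x₀ γ := fun γ hγ => hL γ (by simp [hγ])
      simp only [List.length_cons] at hk
      by_cases hneg : IsPosRoot Γ x₀ ((M.map rootReflection).prod⁻¹ α)
      · have h1 := ih M.length (by omega) M hM rfl
        have h2 := hy _ hneg
        have h3 : ⟪α, (M.map rootReflection).prod y⟫ =
            ⟪(M.map rootReflection).prod⁻¹ α, y⟫ := by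
          rw [← LinearIsometryEquiv.inner_map_map (M.map rootReflection).prod
            ((M.map rootReflection).prod⁻¹ α) y]
          congr 1
          exact ((M.map rootReflection).prod.apply_symm_apply α).symm
        have h4 := hx α hα
        rw [List.map_cons, List.prod_cons, LinearIsometryEquiv.coe_mul, Function.comp_apply,
          rootReflection_apply hα.1, inner_sub_right, real_inner_smul_right, h3,
          real_inner_comm α x]
        nlinarith [mul_nonneg h2 h4]
      · obtain ⟨L', hL', hlen, hprod⟩ := exists_exchange M hM hα hneg
        rw [List.map_cons, List.prod_cons, ← hprod]
        exact ih L'.length (by omega) L' hL' rfl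

lemma exists_list_of_mem_closure_rootReflection {T : Set F} {g : F ≃ₗᵢ[ℝ] F}
    (hg : g ∈ Subgroup.closure (rootReflection '' T)) :
    ∃ L : List F, (∀ β ∈ L, β ∈ T) ∧ (L.map rootReflection).prod = g := by
  induction hg using Subgroup.closure_induction_left with
  | one => exact ⟨[], by simp, rfl⟩
  | mul_left x hx y _ ih =>
    obtain ⟨α, hα, rfl⟩ := hx
    obtain ⟨L, hL, rfl⟩ := ih
    exact ⟨α :: L, by simpa using ⟨hα, hL⟩, by simp⟩
  | inv_mul_cancel x hx y _ ih =>
    obtain ⟨α, hα, rfl⟩ := hx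
    obtain ⟨L, hL, rfl⟩ := ih
    exact ⟨α :: L, by simpa using ⟨hα, hL⟩, by simp⟩

lemma inner_le_of_mem_chamber [Finite Γ] (hx₀ : IsOffMirrors Γ x₀)
    (hΓ : Γ ≤ Subgroup.closure (rootReflection '' {α | ‖α‖ = 1 ∧ rootReflection α ∈ Γ}))
    {x y : F} (hx : x ∈ chamber Γ x₀) (hy : y ∈ chamber Γ x₀) {g : F ≃ₗᵢ[ℝ] F} (hg : g ∈ Γ) :
    ⟪x, g y⟫ ≤ ⟪x, y⟫ := by
  have h : Subgroup.closure (rootReflection '' {α | ‖α‖ = 1 ∧ rootReflection α ∈ Γ}) ≤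
      Subgroup.closure (rootReflection '' {β | IsSimpleRoot Γ x₀ β}) := by
    rw [Subgroup.closure_le]
    rintro _ ⟨α, ⟨hα, hm⟩, rfl⟩
    rcases (hx₀ α hα hm).lt_or_gt with h | h
    · rw [← rootReflection_neg]
      refine rootReflection_mem_closure_simple hx₀
        ⟨by simpa using hα, by rwa [rootReflection_neg], ?_⟩
      rw [inner_neg_left]
      linarith
    · exact rootReflection_mem_closure_simple hx₀ ⟨hα, hm, h⟩
  obtain ⟨L, hL, rfl⟩ := exists_list_of_mem_closure_rootReflection (h (hΓ hg))
  exact inner_list_prod_le hx hy L hL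

lemma exists_map_mem_chamber [Finite Γ] (x₀ x : F) : ∃ g ∈ Γ, g x ∈ chamber Γ x₀ := by
  obtain ⟨⟨g, hg⟩, hmax⟩ := Finite.exists_max fun g : Γ => ⟪(g : F ≃ₗᵢ[ℝ] F) x, x₀⟫
  refine ⟨g, hg, fun α hα => ?_⟩
  have h := hmax ⟨rootReflection α * g, Γ.mul_mem hα.mem hg⟩
  simp only [LinearIsometryEquiv.coe_mul, Function.comp_apply] at h
  rw [rootReflection_apply hα.1, inner_sub_left, real_inner_smul_left] at h
  have := hα.pos
  by_contra! hn
  nlinarith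

end Roots

section Reflections

variable {K : Type} [NormedAddCommGroup K] [InnerProductSpace ℝ K]

lemma mem_fixedSubmodule {g : K ≃ₗᵢ[ℝ] K} {x : K} : x ∈ fixedSubmodule g ↔ g x = x := Iff.rfl

lemma fixedSubmodule_ne_top {g : K ≃ₗᵢ[ℝ] K} (hg : g ≠ 1) : fixedSubmodule g ≠ ⊤ := by
  intro h
  refine hg (LinearIsometryEquiv.ext fun x => ?_)
  exact mem_fixedSubmodule.1 (h ▸ Submodule.mem_top)

lemma IsReflection.exists_eq_rootReflection [FiniteDimensional ℝ K]
    (hK : 1 ≤ Module.finrank ℝ K) {g : K ≃ₗᵢ[ℝ] K} (hg : IsReflection g) :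
    ∃ α, ‖α‖ = 1 ∧ g = rootReflection α := by
  set H := fixedSubmodule g
  have hfin : Module.finrank ℝ Hᗮ = 1 := by
    have h1 := Submodule.finrank_add_finrank_orthogonal H
    have h2 : Module.finrank ℝ H = Module.finrank ℝ K - 1 := hg
    omega
  obtain ⟨⟨v, hv⟩, hv0, hspan⟩ := finrank_eq_one_iff'.1 hfin
  have hv0' : v ≠ 0 := fun h => hv0 (Subtype.ext h)
  set α := (‖v‖⁻¹ : ℝ) • v with hα
  have hαn : ‖α‖ = 1 := norm_smul_inv_norm (𝕜 := ℝ) hv0'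
  have hαH : α ∈ Hᗮ := Hᗮ.smul_mem _ hv
  have hHspan : ∀ w ∈ Hᗮ, ∃ c : ℝ, w = c • α := by
    intro w hw
    obtain ⟨c, hc⟩ := hspan ⟨w, hw⟩
    refine ⟨c * ‖v‖, ?_⟩
    rw [hα, smul_smul, mul_assoc, mul_inv_cancel₀ (norm_ne_zero_iff.2 hv0'), mul_one]
    exact (congrArg Subtype.val hc).symm
  clear_value α
  have hgα : g α ∈ Hᗮ := by
    rw [Submodule.mem_orthogonal]
    intro u hu
    rw [← mem_fixedSubmodule.1 hu, g.inner_map_map]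
    exact (Submodule.mem_orthogonal _ _).1 hαH u hu
  obtain ⟨c, hc⟩ := hHspan _ hgα
  have hcabs : |c| = 1 := by
    have := congrArg norm hc
    rwa [g.norm_map, norm_smul, hαn, mul_one, Real.norm_eq_abs, eq_comm] at this
  have hneg : g α = -α := by
    rcases eq_or_eq_neg_of_abs_eq hcabs with h | h
    · rw [h, one_smul] at hc
      have h0 := (Submodule.mem_orthogonal _ _).1 hαH α hc
      rw [real_inner_self_eq_norm_sq, hαn] at h0
      norm_num at h0
    · rw [hc, h, neg_one_smul]
  refine ⟨α, hαn, LinearIsometryEquiv.ext fun x => ?_⟩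
  have hx : x - ⟪α, x⟫ • α ∈ H := by
    rw [← Submodule.orthogonal_orthogonal H, Submodule.mem_orthogonal]
    intro u hu
    obtain ⟨d, rfl⟩ := hHspan u hu
    rw [inner_sub_right, real_inner_smul_left, real_inner_smul_right, real_inner_smul_left,
      real_inner_self_eq_norm_sq, hαn]
    ring
  have hx' := mem_fixedSubmodule.1 hx
  rw [map_sub, map_smul, hneg, smul_neg, sub_neg_eq_add, ← eq_sub_iff_add_eq] at hx'
  rw [hx', rootReflection_apply hαn, two_mul, add_smul, sub_sub]

lemma fixedSubmodule_sup_span_ne_top [FiniteDimensional ℝ K] {g : K ≃ₗᵢ[ℝ] K} (hg : g ≠ 1)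
    (hr : ¬ IsReflection g) (y : K) : fixedSubmodule g ⊔ (ℝ ∙ y) ≠ ⊤ := by
  intro h
  have h1 := Submodule.finrank_add_le_finrank_add_finrank (fixedSubmodule g) (ℝ ∙ y)
  rw [h, finrank_top] at h1
  have h2 : Module.finrank ℝ (ℝ ∙ y) ≤ 1 := by
    simpa using finrank_span_le_card ({y} : Set K)
  have h3 := Submodule.finrank_lt (fixedSubmodule_ne_top hg)
  unfold IsReflection at hr
  omega

lemma exists_mem_forall_notMem_of_ne_top [FiniteDimensional ℝ K] {ι : Type*} [Finite ι]
    {p : ι → Submodule ℝ K} (hp : ∀ i, p i ≠ ⊤) {O : Set K} (hO : IsOpen O) (hne : O.Nonempty) :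
    ∃ z ∈ O, ∀ i, z ∉ p i := by
  have : CompleteSpace K := FiniteDimensional.complete ℝ K
  have hd : Dense (⋂ i, ((p i : Set K))ᶜ) := by
    refine dense_iInter_of_isOpen (fun i => (p i).closed_of_finiteDimensional.isOpen_compl)
      fun i => ?_
    rw [← interior_eq_empty_iff_dense_compl, ← Set.not_nonempty_iff_eq_empty]
    exact fun h => hp i ((p i).eq_top_of_nonempty_interior' h)
  obtain ⟨z, hzO, hz⟩ := hd.inter_open_nonempty O hO hne
  exact ⟨z, hzO, fun i hi => Set.mem_iInter.1 hz i hi⟩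

lemma exists_trivial_stabilizer [FiniteDimensional ℝ K] (Γ : Subgroup (K ≃ₗᵢ[ℝ] K)) [Finite Γ] :
    ∃ x : K, ∀ g ∈ Γ, g x = x → g = 1 := by
  obtain ⟨x, -, hx⟩ := exists_mem_forall_notMem_of_ne_top
    (p := fun g : {g : Γ // (g : K ≃ₗᵢ[ℝ] K) ≠ 1} => fixedSubmodule (g : K ≃ₗᵢ[ℝ] K))
    (fun g => fixedSubmodule_ne_top g.2) isOpen_univ Set.univ_nonempty
  refine ⟨x, fun g hg h => ?_⟩
  by_contra hne
  exact hx ⟨⟨g, hg⟩, hne⟩ h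

lemma isOffMirrors_of_trivial_stabilizer {Γ : Subgroup (K ≃ₗᵢ[ℝ] K)} {x₀ : K}
    (hx₀ : ∀ g ∈ Γ, g x₀ = x₀ → g = 1) : IsOffMirrors Γ x₀ := by
  intro α hα hm h0
  have h := hx₀ _ hm (by simp [rootReflection_apply hα, h0])
  have h1 := rootReflection_self α
  rw [h, LinearIsometryEquiv.coe_one, id] at h1
  have : IsAddTorsionFree K := .of_isTorsionFree ℝ K
  simp [self_eq_neg.1 h1] at hα

end Reflections

section QuotientMetric

variable {n : ℕ} {Γ : Subgroup (On n)}

/-- The orbit of a point of `ℝⁿ`, as a point of `ℝⁿ/Γ`. -/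
def orbitMk (Γ : Subgroup (On n)) (x : E n) : Quotient (orbitSetoid Γ) := Quotient.mk _ x

lemma orbitMk_eq_iff {x y : E n} : orbitMk Γ x = orbitMk Γ y ↔ ∃ g ∈ Γ, g y = x :=
  Quotient.eq

lemma orbitMk_map {g : On n} (hg : g ∈ Γ) (x : E n) : orbitMk Γ (g x) = orbitMk Γ x :=
  orbitMk_eq_iff.2 ⟨g, hg, rfl⟩

lemma orbitMk_surjective : Function.Surjective (orbitMk Γ) := Quotient.mk_surjective

lemma orbitMk_out (X : Quotient (orbitSetoid Γ)) : orbitMk Γ X.out = X := Quotient.out_eq X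

lemma dist_map_left (g : On n) (x y : E n) : dist (g x) y = dist x (g⁻¹ y) := by
  rw [← g.dist_map x]
  congr 1
  exact (g.apply_symm_apply y).symm

lemma quotDist_le [Finite Γ] (x y : E n) : quotDist Γ (orbitMk Γ x) (orbitMk Γ y) ≤ dist x y := by
  obtain ⟨a, ha, hax⟩ := orbitMk_eq_iff.1 (orbitMk_out (orbitMk Γ x))
  obtain ⟨b, hb, hby⟩ := orbitMk_eq_iff.1 (orbitMk_out (orbitMk Γ y))
  refine (ciInf_le (Set.finite_range _).bddBelow
    (⟨a * b⁻¹, Γ.mul_mem ha (Γ.inv_mem hb)⟩ : Γ)).trans_eq ?_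
  change dist _ (a (b.symm _)) = _
  rw [← hax, ← hby, b.symm_apply_apply, a.dist_map]

lemma exists_quotDist_eq [Finite Γ] (x y : E n) :
    ∃ g ∈ Γ, quotDist Γ (orbitMk Γ x) (orbitMk Γ y) = dist x (g y) := by
  obtain ⟨a, ha, hax⟩ := orbitMk_eq_iff.1 (orbitMk_out (orbitMk Γ x))
  obtain ⟨b, hb, hby⟩ := orbitMk_eq_iff.1 (orbitMk_out (orbitMk Γ y))
  obtain ⟨⟨g, hg⟩, h⟩ := exists_eq_ciInf_of_finite
    (f := fun g : Γ => dist (orbitMk Γ x).out ((g : On n) (orbitMk Γ y).out))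
  refine ⟨a⁻¹ * (g * b), Γ.mul_mem (Γ.inv_mem ha) (Γ.mul_mem hg hb), ?_⟩
  rw [quotDist, ← h]
  change dist _ (g _) = _
  rw [← hax, ← hby, dist_map_left]
  rfl

lemma quotDist_nonneg (X Y : Quotient (orbitSetoid Γ)) : 0 ≤ quotDist Γ X Y :=
  Real.iInf_nonneg fun _ => dist_nonneg

lemma isMetricFn_quotDist (Γ : Subgroup (On n)) [Finite Γ] : IsMetricFn (quotDist Γ) := by
  have hsymm : ∀ x y, quotDist Γ (orbitMk Γ x) (orbitMk Γ y) ≤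
      quotDist Γ (orbitMk Γ y) (orbitMk Γ x) := by
    intro x y
    obtain ⟨g, hg, h⟩ := exists_quotDist_eq (Γ := Γ) y x
    rw [h, dist_comm, ← orbitMk_map hg x]
    exact quotDist_le _ _
  refine ⟨fun X Y => ?_, fun X Y => ?_, fun X Y Z => ?_⟩
  · obtain ⟨x, rfl⟩ := orbitMk_surjective X
    obtain ⟨y, rfl⟩ := orbitMk_surjective Y
    constructor
    · intro h
      obtain ⟨g, hg, hd⟩ := exists_quotDist_eq (Γ := Γ) x y
      exact orbitMk_eq_iff.2 ⟨g, hg, (dist_eq_zero.1 (hd.symm.trans h)).symm⟩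
    · intro h
      rw [h]
      exact le_antisymm ((quotDist_le y y).trans_eq (dist_self y)) (quotDist_nonneg _ _)
  · obtain ⟨x, rfl⟩ := orbitMk_surjective X
    obtain ⟨y, rfl⟩ := orbitMk_surjective Y
    exact le_antisymm (hsymm x y) (hsymm y x)
  · obtain ⟨x, rfl⟩ := orbitMk_surjective X
    obtain ⟨y, rfl⟩ := orbitMk_surjective Y
    obtain ⟨z, rfl⟩ := orbitMk_surjective Z
    obtain ⟨g, hg, hd⟩ := exists_quotDist_eq (Γ := Γ) x y
    obtain ⟨k, hk, hd'⟩ := exists_quotDist_eq (Γ := Γ) y z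
    rw [hd, hd', ← g.dist_map y, ← orbitMk_map (Γ.mul_mem hg hk) z]
    exact (quotDist_le _ _).trans (dist_triangle _ _ _)

/-- A segment realizing the distance between two orbits projects to a geodesic. -/
lemma isGeodesicFn_lineMap [Finite Γ] {x a : E n}
    (h : quotDist Γ (orbitMk Γ x) (orbitMk Γ a) = dist x a) :
    IsGeodesicFn (quotDist Γ) (orbitMk Γ x) (orbitMk Γ a)
      fun s => orbitMk Γ (AffineMap.lineMap x a (s / dist x a)) := by
  obtain ⟨-, hsymm, htri⟩ := isMetricFn_quotDist Γ
  rw [IsGeodesicFn, h]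
  have h0 : orbitMk Γ (AffineMap.lineMap x a (0 / dist x a)) = orbitMk Γ x := by simp
  have h1 : orbitMk Γ (AffineMap.lineMap x a (dist x a / dist x a)) = orbitMk Γ a := by
    rcases eq_or_ne x a with rfl | hne
    · simp
    · simp [div_self (dist_ne_zero.2 hne)]
  refine ⟨h0, h1, ?_⟩
  have hle : ∀ s ∈ Set.Icc 0 (dist x a), ∀ t ∈ Set.Icc 0 (dist x a),
      quotDist Γ (orbitMk Γ (AffineMap.lineMap x a (s / dist x a)))
        (orbitMk Γ (AffineMap.lineMap x a (t / dist x a))) ≤ |s - t| := by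
    intro s hs t ht
    refine (quotDist_le _ _).trans ?_
    rw [dist_lineMap_lineMap, Real.dist_eq, ← sub_div, abs_div, abs_of_nonneg dist_nonneg]
    rcases eq_or_ne (dist x a) 0 with hD | hD
    · simp [hD]
    · rw [div_mul_cancel₀ _ hD]
  have hge : ∀ s ∈ Set.Icc 0 (dist x a), ∀ t ∈ Set.Icc 0 (dist x a), s ≤ t →
      t - s ≤ quotDist Γ (orbitMk Γ (AffineMap.lineMap x a (s / dist x a)))
        (orbitMk Γ (AffineMap.lineMap x a (t / dist x a))) := by
    intro s hs t ht hst
    have e1 := hle 0 ⟨le_rfl, dist_nonneg⟩ s hs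
    have e2 := hle t ht (dist x a) ⟨dist_nonneg, le_rfl⟩
    rw [h0, zero_sub, abs_neg, abs_of_nonneg hs.1] at e1
    rw [h1, abs_of_nonpos (by linarith [ht.2])] at e2
    have e3 := htri (orbitMk Γ x) (orbitMk Γ (AffineMap.lineMap x a (s / dist x a)))
      (orbitMk Γ a)
    have e4 := htri (orbitMk Γ (AffineMap.lineMap x a (s / dist x a)))
      (orbitMk Γ (AffineMap.lineMap x a (t / dist x a))) (orbitMk Γ a)
    linarith
  intro s hs t ht
  refine le_antisymm (hle s hs t ht) ?_
  rcases le_total s t with hst | hst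
  · rw [abs_sub_comm, abs_of_nonneg (sub_nonneg.2 hst)]
    exact hge s hs t ht hst
  · rw [abs_of_nonneg (sub_nonneg.2 hst), hsymm]
    exact hge t ht s hs hst

end QuotientMetric

section CAT0ToReflections

variable {n : ℕ} {Γ : Subgroup (On n)}

/-- Geodesics with the same endpoints in a CAT(0) space agree. -/
lemma IsCAT0.geodesic_unique {X : Type*} {d : X → X → ℝ} (hd : IsCAT0 d) {p q : X}
    {γ γ' : ℝ → X} (hγ : IsGeodesicFn d p q γ) (hγ' : IsGeodesicFn d p q γ')
    (hpq : 0 ≤ d p q) (hnonneg : ∀ x y, 0 ≤ d x y) {s : ℝ} (hs : s ∈ Set.Icc 0 (d p q)) :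
    γ s = γ' s := by
  obtain ⟨⟨hzero, -, -⟩, -, hcomp⟩ := hd
  have hdist : dist (0 : EuclideanSpace ℝ (Fin 2)) (EuclideanSpace.single 0 (d p q)) = d p q := by
    simp [dist_zero_left, abs_of_nonneg hpq]
  have h := hcomp p q q γ γ' hγ hγ' 0 (EuclideanSpace.single 0 (d p q))
    (EuclideanSpace.single 0 (d p q)) hdist hdist
    (by rw [dist_self, (hzero q q).2 rfl]) s hs s hs
  rw [dist_self] at h
  exact (hzero _ _).1 (le_antisymm h (hnonneg _ _))

/-- In a CAT(0) orbit space, the points of an orbit nearest to `x` form a single orbit of the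
stabilizer of `x`. -/
lemma exists_stabilizer_map_eq [Finite Γ] (hcat : IsCAT0 (quotDist Γ)) {x a b : E n}
    (hab : orbitMk Γ a = orbitMk Γ b)
    (ha : quotDist Γ (orbitMk Γ x) (orbitMk Γ a) = dist x a)
    (hb : quotDist Γ (orbitMk Γ x) (orbitMk Γ b) = dist x b) :
    ∃ h ∈ Γ, h x = x ∧ h a = b := by
  have hD : dist x a = dist x b := by rw [← ha, ← hb, hab]
  have hagree : ∀ u ∈ Set.Icc (0 : ℝ) 1, ∃ h ∈ Γ,
      h (AffineMap.lineMap x b u) = AffineMap.lineMap x a u := by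
    intro u hu
    rcases eq_or_ne (dist x a) 0 with h0 | h0
    · have hxa := dist_eq_zero.1 h0
      have hxb := dist_eq_zero.1 (hD ▸ h0)
      refine ⟨1, Γ.one_mem, ?_⟩
      rw [← hxa, ← hxb]
      rfl
    have hga := isGeodesicFn_lineMap ha
    have hgb := isGeodesicFn_lineMap hb
    rw [← hab, ← hD] at hgb
    have hs : u * dist x a ∈ Set.Icc 0 (quotDist Γ (orbitMk Γ x) (orbitMk Γ a)) := by
      rw [ha]
      exact ⟨mul_nonneg hu.1 dist_nonneg, mul_le_of_le_one_left dist_nonneg hu.2⟩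
    have := hcat.geodesic_unique hga hgb (quotDist_nonneg _ _) quotDist_nonneg hs
    simp only [mul_div_cancel_right₀ _ h0] at this
    exact orbitMk_eq_iff.1 this
  have hu : ∀ k : ℕ, (1 / ((k : ℝ) + 1)) ∈ Set.Icc (0 : ℝ) 1 := fun k =>
    ⟨by positivity, by rw [div_le_one (by positivity)]; linarith [(k.cast_nonneg : (0 : ℝ) ≤ k)]⟩
  choose f hf hfe using fun k : ℕ => hagree _ (hu k)
  obtain ⟨k, l, hkl, hfkl⟩ := Finite.exists_ne_map_eq_of_infinite
    fun k => (⟨f k, hf k⟩ : Γ)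
  have hfkl : f k = f l := congrArg Subtype.val hfkl
  set u := 1 / ((k : ℝ) + 1)
  set v := 1 / ((l : ℝ) + 1)
  have huv : u - v ≠ 0 := by
    rw [sub_ne_zero]
    intro h
    have : (k : ℝ) + 1 = l + 1 := by simpa [u, v] using h
    exact hkl (by exact_mod_cast add_right_cancel this)
  have e1 : f l (u • (b - x) + x) = u • (a - x) + x := by
    have := hfe k
    rwa [hfkl, AffineMap.lineMap_apply_module', AffineMap.lineMap_apply_module'] at this
  have e2 : f l (v • (b - x) + x) = v • (a - x) + x := by
    have := hfe l
    rwa [AffineMap.lineMap_apply_module', AffineMap.lineMap_apply_module'] at this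
  rw [map_add, map_smul] at e1 e2
  have e3 : f l (b - x) = a - x := by
    refine smul_right_injective (E n) huv ?_
    simp only [sub_smul]
    simpa using congrArg₂ (· - ·) e1 e2
  have e4 : f l x = x := by
    rw [e3] at e1
    exact add_left_cancel e1
  have e5 : f l b = a := by
    rw [map_sub, e4] at e3
    exact sub_left_injective e3
  refine ⟨(f l)⁻¹, Γ.inv_mem (hf l), ?_, ?_⟩
  · exact (f l).symm_apply_eq.2 e4.symm
  · exact (f l).symm_apply_eq.2 e5.symm

lemma real_inner_lt_inner_self {F : Type*} [NormedAddCommGroup F] [InnerProductSpace ℝ F]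
    {a b : F} (hn : ‖a‖ = ‖b‖) (hne : a ≠ b) : ⟪a, b⟫ < ⟪a, a⟫ := by
  have h := norm_sub_sq_real a b
  have hpos : 0 < ‖a - b‖ := norm_pos_iff.2 (sub_ne_zero.2 hne)
  rw [real_inner_self_eq_norm_sq]
  rw [← hn] at h
  nlinarith

lemma dist_le_dist_iff_inner_le {F : Type*} [NormedAddCommGroup F] [InnerProductSpace ℝ F]
    {a b : F} (hn : ‖a‖ = ‖b‖) (x : F) : dist x a ≤ dist x b ↔ ⟪x, b⟫ ≤ ⟪x, a⟫ := by
  rw [dist_eq_norm, dist_eq_norm, ← sq_le_sq₀ (norm_nonneg _) (norm_nonneg _),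
    norm_sub_sq_real, norm_sub_sq_real, hn]
  constructor <;> intro h <;> linarith

lemma isOpen_exists_forall_inner_lt {F : Type*} [NormedAddCommGroup F] [InnerProductSpace ℝ F]
    (A : Set F) {B : Set F} (hB : B.Finite) :
    IsOpen {x : F | ∃ a ∈ A, ∀ b ∈ B, ⟪x, b⟫ < ⟪x, a⟫} := by
  have : {x : F | ∃ a ∈ A, ∀ b ∈ B, ⟪x, b⟫ < ⟪x, a⟫} =
      ⋃ a ∈ A, ⋂ b ∈ B, {x : F | ⟪x, b⟫ < ⟪x, a⟫} := by
    ext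
    simp
  rw [this]
  exact isOpen_biUnion fun a _ => hB.isOpen_biInter fun b _ =>
    isOpen_lt (by fun_prop) (by fun_prop)

lemma IsCAT0.generatedByReflections [Finite Γ] (hcat : IsCAT0 (quotDist Γ)) :
    GeneratedByReflections Γ := by
  unfold GeneratedByReflections
  set R := Subgroup.closure {g : On n | g ∈ Γ ∧ IsReflection g} with hR
  have hRΓ : R ≤ Γ := (Subgroup.closure_le _).2 fun g hg => hg.1
  refine le_antisymm hRΓ fun g hg => ?_
  by_contra hgR
  obtain ⟨y, hy⟩ := exists_trivial_stabilizer Γ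
  set A : Set (E n) := {a | ∃ k ∈ R, k y = a}
  set B : Set (E n) := {b | ∃ k ∈ Γ, k ∉ R ∧ k y = b}
  have hAfin : A.Finite := ((Set.toFinite (Γ : Set (On n))).image fun k => k y).subset
    fun a ⟨k, hk, h⟩ => ⟨k, hRΓ hk, h⟩
  have hBfin : B.Finite := ((Set.toFinite (Γ : Set (On n))).image fun k => k y).subset
    fun a ⟨k, hk, _, h⟩ => ⟨k, hk, h⟩
  have hyA : y ∈ A := ⟨1, R.one_mem, rfl⟩
  have hgB : g y ∈ B := ⟨g, hg, hgR, rfl⟩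
  have hAn : ∀ a ∈ A, ‖a‖ = ‖y‖ := by
    rintro _ ⟨k, -, rfl⟩
    exact k.norm_map y
  have hBn : ∀ b ∈ B, ‖b‖ = ‖y‖ := by
    rintro _ ⟨k, -, -, rfl⟩
    exact k.norm_map y
  have hAB : ∀ a ∈ A, ∀ b ∈ B, a ≠ b := by
    rintro _ ⟨r, hr, rfl⟩ _ ⟨k, hk, hkR, rfl⟩ h
    have h1 := hy (r⁻¹ * k) (Γ.mul_mem (Γ.inv_mem (hRΓ hr)) hk) (r.symm_apply_eq.2 h.symm)
    exact hkR ((inv_mul_eq_one.1 h1) ▸ hr)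
  have hO₁ := isOpen_exists_forall_inner_lt A hBfin
  have hO₂ := isOpen_exists_forall_inner_lt B hAfin
  set O₁ := {x : E n | ∃ a ∈ A, ∀ b ∈ B, ⟪x, b⟫ < ⟪x, a⟫}
  set O₂ := {x : E n | ∃ b ∈ B, ∀ a ∈ A, ⟪x, a⟫ < ⟪x, b⟫}
  have hyO : y ∈ O₁ := ⟨y, hyA, fun b hb =>
    real_inner_lt_inner_self (hBn b hb).symm (hAB y hyA b hb)⟩
  have hgO : g y ∈ O₂ := ⟨g y, hgB, fun a ha =>
    real_inner_lt_inner_self ((g.norm_map y).trans (hAn a ha).symm) (hAB a ha _ hgB).symm⟩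
  obtain ⟨z, hzO, hz⟩ := exists_mem_forall_notMem_of_ne_top
    (p := fun h : {h : Γ // (h : On n) ∉ R} => fixedSubmodule (h : On n) ⊔ (ℝ ∙ y))
    (fun h => fixedSubmodule_sup_span_ne_top (fun h1 => h.2 (by rw [h1]; exact R.one_mem))
      (fun hr => h.2 (Subgroup.subset_closure ⟨h.1.2, hr⟩)) y) hO₂ ⟨_, hgO⟩
  have hstab : ∀ x ∈ segment ℝ y z, ∀ h ∈ Γ, h x = x → h ∈ R := by
    rintro x ⟨s, t, -, -, hst, rfl⟩ h hh hfix
    by_contra hhR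
    rcases eq_or_ne t 0 with rfl | ht
    · have hs : s = 1 := by linarith
      subst hs
      simp only [one_smul, zero_smul, add_zero] at hfix
      exact hhR (hy h hh hfix ▸ R.one_mem)
    · refine hz ⟨⟨h, hh⟩, hhR⟩ ?_
      have hz' : z = t⁻¹ • (s • y + t • z) + (-(t⁻¹ * s)) • y := by
        rw [smul_add, smul_smul, smul_smul, inv_mul_cancel₀ ht, one_smul, neg_smul]
        abel
      rw [hz']
      exact Submodule.add_mem_sup (Submodule.smul_mem _ _ hfix)
        (Submodule.smul_mem _ _ (Submodule.mem_span_singleton_self y))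
  have hcover : segment ℝ y z ⊆ O₁ ∪ O₂ := by
    intro x hx
    obtain ⟨a, ha, hamax⟩ := Set.exists_max_image A (fun a => ⟪x, a⟫) hAfin ⟨y, hyA⟩
    obtain ⟨b, hb, hbmax⟩ := Set.exists_max_image B (fun b => ⟪x, b⟫) hBfin ⟨_, hgB⟩
    rcases lt_trichotomy ⟪x, a⟫ ⟪x, b⟫ with hlt | heq | hlt
    · exact .inr ⟨b, hb, fun a' ha' => (hamax a' ha').trans_lt hlt⟩
    · exfalso
      have hnearest : ∀ c, orbitMk Γ c = orbitMk Γ y → ‖c‖ = ‖y‖ → ⟪x, c⟫ = ⟪x, a⟫ →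
          quotDist Γ (orbitMk Γ x) (orbitMk Γ c) = dist x c := by
        intro c hc hcn hca
        refine le_antisymm (quotDist_le x c) ?_
        obtain ⟨k, hk, hd⟩ := exists_quotDist_eq (Γ := Γ) x y
        rw [hc, hd, dist_le_dist_iff_inner_le (hcn.trans (k.norm_map y).symm), hca]
        by_cases hkR : k ∈ R
        · exact hamax _ ⟨k, hkR, rfl⟩
        · exact (hbmax _ ⟨k, hk, hkR, rfl⟩).trans_eq heq.symm
      obtain ⟨r, hr, hra⟩ := ha
      obtain ⟨k, hk, hkR, hkb⟩ := hb
      have ha' : orbitMk Γ a = orbitMk Γ y := orbitMk_eq_iff.2 ⟨r, hRΓ hr, hra⟩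
      have hb' : orbitMk Γ b = orbitMk Γ y := orbitMk_eq_iff.2 ⟨k, hk, hkb⟩
      obtain ⟨h, hh, hhx, hhab⟩ := exists_stabilizer_map_eq hcat (ha'.trans hb'.symm)
        (hnearest a ha' (hAn a ⟨r, hr, hra⟩) rfl)
        (hnearest b hb' (hBn b ⟨k, hk, hkR, hkb⟩) heq.symm)
      refine hAB b ⟨h * r, R.mul_mem (hstab x hx h hh hhx) hr, ?_⟩ b ⟨k, hk, hkR, hkb⟩ rfl
      rw [← hhab, ← hra]
      rfl
    · exact .inl ⟨a, ha, fun b' hb' => (hbmax b' hb').trans_lt hlt⟩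
  obtain ⟨x, -, ⟨a, ha, hab⟩, ⟨b, hb, hba⟩⟩ := (convex_segment y z).isPreconnected O₁ O₂ hO₁ hO₂
    hcover ⟨y, left_mem_segment ℝ y z, hyO⟩ ⟨z, right_mem_segment ℝ y z, hzO⟩
  exact lt_asymm (hab b hb) (hba a ha)

end CAT0ToReflections

section ReflectionsToCAT0

lemma sq_dist_lineMap_lineMap {F : Type*} [NormedAddCommGroup F] [InnerProductSpace ℝ F]
    (p q r : F) (u v : ℝ) :
    dist (AffineMap.lineMap p q u) (AffineMap.lineMap p r v : F) ^ 2 =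
      u ^ 2 * dist p q ^ 2 + v ^ 2 * dist p r ^ 2 -
        u * v * (dist p q ^ 2 + dist p r ^ 2 - dist q r ^ 2) := by
  have hqr : dist q r = ‖(q - p) - (r - p)‖ := by
    rw [dist_eq_norm, sub_sub_sub_cancel_right]
  have hlm : dist (AffineMap.lineMap p q u) (AffineMap.lineMap p r v : F) =
      ‖u • (q - p) - v • (r - p)‖ := by
    rw [dist_eq_norm, AffineMap.lineMap_apply_module', AffineMap.lineMap_apply_module',
      add_sub_add_right_eq_sub]
  rw [hlm, hqr, dist_comm p q, dist_comm p r, dist_eq_norm q p, dist_eq_norm r p,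
    norm_sub_sq_real (u • _), norm_sub_sq_real (q - p), real_inner_smul_left,
    real_inner_smul_right, norm_smul, norm_smul,
    mul_pow, mul_pow, Real.norm_eq_abs, Real.norm_eq_abs, sq_abs, sq_abs]
  ring

/-- The distance between points on two sides of a triangle is determined by the side lengths. -/
lemma dist_lineMap_eq_of_dist_eq {F G : Type*} [NormedAddCommGroup F] [InnerProductSpace ℝ F]
    [NormedAddCommGroup G] [InnerProductSpace ℝ G] {p q r : F} {p' q' r' : G}
    (hpq : dist p' q' = dist p q) (hpr : dist p' r' = dist p r) (hqr : dist q' r' = dist q r)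
    (u v : ℝ) :
    dist (AffineMap.lineMap p q u) (AffineMap.lineMap p r v) =
      dist (AffineMap.lineMap p' q' u) (AffineMap.lineMap p' r' v) := by
  have h := sq_dist_lineMap_lineMap p q r u v
  rw [← hpq, ← hpr, ← hqr, ← sq_dist_lineMap_lineMap] at h
  exact (sq_eq_sq₀ dist_nonneg dist_nonneg).1 h

variable {n : ℕ} {Γ : Subgroup (On n)}

/-- An orbit space with an isometric section is CAT(0). -/
lemma isCAT0_quotDist_of_section [Finite Γ] {C : Set (E n)}
    (hdist : ∀ x ∈ C, ∀ y ∈ C, quotDist Γ (orbitMk Γ x) (orbitMk Γ y) = dist x y)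
    (hsurj : ∀ X : Quotient (orbitSetoid Γ), ∃ x ∈ C, orbitMk Γ x = X) :
    IsCAT0 (quotDist Γ) := by
  choose c hcC hc using hsurj
  have hcd : ∀ X Y, dist (c X) (c Y) = quotDist Γ X Y := by
    intro X Y
    rw [← hdist _ (hcC X) _ (hcC Y), hc, hc]
  refine ⟨isMetricFn_quotDist Γ, fun X Y => ?_, ?_⟩
  · have := isGeodesicFn_lineMap (hdist _ (hcC X) _ (hcC Y))
    rw [hc, hc] at this
    exact ⟨_, this⟩
  · have hgeo : ∀ p q γ, IsGeodesicFn (quotDist Γ) p q γ →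
        ∀ s ∈ Set.Icc 0 (quotDist Γ p q),
          c (γ s) = AffineMap.lineMap (c p) (c q) (s / quotDist Γ p q) := by
      rintro p q γ ⟨h0, h1, hγ⟩ s hs
      have hD := quotDist_nonneg p q
      have e1 := hγ 0 ⟨le_rfl, hD⟩ s hs
      have e2 := hγ s hs _ ⟨hD, le_rfl⟩
      rw [h0, ← hcd, zero_sub, abs_neg, abs_of_nonneg hs.1] at e1
      rw [h1, ← hcd, abs_of_nonpos (by linarith [hs.2])] at e2
      rcases eq_or_ne (quotDist Γ p q) 0 with h | h
      · have hs0 : s = 0 := le_antisymm (h ▸ hs.2) hs.1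
        rw [hs0] at e1
        simpa [hs0, eq_comm] using e1
      · apply eq_lineMap_of_dist_eq_mul_of_dist_eq_mul
        · rw [e1, hcd, div_mul_cancel₀ _ h]
        · rw [e2, hcd]
          field_simp
          ring
    intro p q r γpq γpr hpq hpr p' q' r' e1 e2 e3 s hs t ht
    rw [← hcd, hgeo _ _ _ hpq s hs, hgeo _ _ _ hpr t ht]
    rw [← hcd] at e1 e2 e3
    exact (dist_lineMap_eq_of_dist_eq e1 e2 e3 _ _).le

lemma GeneratedByReflections.isCAT0 (hn : 1 ≤ n) [Finite Γ] (hΓ : GeneratedByReflections Γ) :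
    IsCAT0 (quotDist Γ) := by
  obtain ⟨x₀, hx₀⟩ := exists_trivial_stabilizer Γ
  have hroots : Γ ≤ Subgroup.closure
      (rootReflection '' {α | ‖α‖ = 1 ∧ rootReflection α ∈ Γ}) := by
    conv_lhs => rw [← hΓ]
    refine Subgroup.closure_mono ?_
    rintro g ⟨hg, hr⟩
    obtain ⟨α, hα, rfl⟩ := hr.exists_eq_rootReflection (by simpa using hn)
    exact ⟨α, ⟨hα, hg⟩, rfl⟩
  refine isCAT0_quotDist_of_section (C := chamber Γ x₀) (fun x hx y hy => ?_)
    fun X => ?_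
  · refine le_antisymm (quotDist_le x y) ?_
    obtain ⟨g, hg, hd⟩ := exists_quotDist_eq (Γ := Γ) x y
    rw [hd, dist_le_dist_iff_inner_le (g.norm_map y).symm]
    exact inner_le_of_mem_chamber (isOffMirrors_of_trivial_stabilizer hx₀) hroots hx hy hg
  · obtain ⟨x, rfl⟩ := orbitMk_surjective X
    obtain ⟨g, hg, hgx⟩ := exists_map_mem_chamber (Γ := Γ) x₀ x
    exact ⟨g x, hgx, orbitMk_map hg x⟩

end ReflectionsToCAT0

/-- For a finite subgroup `Γ ≤ O(n)` (`n ≥ 1`), the quotient metric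
space `ℝⁿ/Γ` is CAT(0) if and only if `Γ` is generated by reflections. -/
theorem stmt2 (n : ℕ) (hn : 1 ≤ n) (Γ : Subgroup (On n)) (hfin : Finite Γ) :
    IsCAT0 (quotDist Γ) ↔ GeneratedByReflections Γ :=
  ⟨fun h => h.generatedByReflections, fun h => h.isCAT0 hn⟩

end
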